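/- Let T be a complete first-order theory with infinite models. Define Γ^na, the non-algebraicity bigness notion, in a single variable x with A_{Γ^na} = ∅, by: φ(x, ā) is Γ^na-big in a model M of T iff for every natural number n the formula φ(x, ā) has at least n solutions in M. Then Γ^na is an ℵ1-presentable invariant local bigness notion for T, and, regarded as a global bigness notion, Γ^na is orthogonal to every invariant global bigness notion for T. -/

import Mathlib

namespace Shelah482

open FirstOrder Language Cardinal

universe u

variable {L : FirstOrder.Language.{u, u}} {T : L.Theory} {γ : Type u}

/-- The conjunction of a finite list of formulas. -/
def listConj {α : Type u} : List (L.Formula α) → L.Formula α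
  | [] => ⊤
  | φ :: l => φ ⊓ listConj l

/-- A *local bigness notion* `Γ` for a theory `T` (here the parameter set `A_Γ` of `Γ`
is absorbed into the language as constant symbols, so that all models of the complete
theory `T` elementarily extend `M_Γ` after naming these parameters): for every model
`M` of `T` it declares certain formulas `φ(x̄_Γ, ā)` with parameters `ā` from `M` to be
*`Γ`-big* (the remaining ones being *`Γ`-small*), in such a way that the `Γ`-small
formulas form a proper ideal which is preserved by all automorphisms of `M` (such
automorphisms automatically fix the parameters `A_Γ`, being constants, pointwise). -/
structure LocalBigness (L : FirstOrder.Language.{u, u}) (T : L.Theory) (γ : Type u) :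
    Type (u + 1) where
  Big : ∀ M : Theory.ModelType.{u, u, u} T, L.Formula (γ ⊕ M) → Prop
  aut_invariant : ∀ (M : Theory.ModelType.{u, u, u} T) (g : M ≃[L] M)
      (φ : L.Formula (γ ⊕ M)), Big M (φ.relabel (Sum.map id ⇑g)) ↔ Big M φ
  mono : ∀ (M : Theory.ModelType.{u, u, u} T) (φ ψ : L.Formula (γ ⊕ M)),
      (∀ x : γ → M, φ.Realize (Sum.elim x id) → ψ.Realize (Sum.elim x id)) →
      Big M φ → Big M ψ
  small_sup : ∀ (M : Theory.ModelType.{u, u, u} T) (φ ψ : L.Formula (γ ⊕ M)),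
      ¬ Big M φ → ¬ Big M ψ → ¬ Big M (φ ⊔ ψ)
  small_bot : ∀ M : Theory.ModelType.{u, u, u} T, ¬ Big M (⊥ : L.Formula (γ ⊕ M))
  exists_big : ∀ M : Theory.ModelType.{u, u, u} T, ∃ φ, Big M φ

/-- The complete type of the tuple `a` over the parameter set `A` in `M`. -/
def typeOf (M : Theory.ModelType.{u, u, u} T) (A : Set M) (a : γ → M) :
    Set (L.Formula (γ ⊕ ↥A)) :=
  { φ | φ.Realize (Sum.elim a Subtype.val) }

/-- A (partial) type `p` over `A ⊆ M` is `Γ`-big in `M` if the conjunction of every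
finite subset of `p` is a `Γ`-big formula in `M`. -/
def LocalBigness.BigType (Γ : LocalBigness L T γ) (M : Theory.ModelType.{u, u, u} T)
    (A : Set M) (p : Set (L.Formula (γ ⊕ ↥A))) : Prop :=
  ∀ l : List (L.Formula (γ ⊕ ↥A)), (∀ φ ∈ l, φ ∈ p) →
    Γ.Big M ((listConj l).relabel (Sum.map id Subtype.val))

/-- `q` is a complete type over `A` in `M` (in the variables `γ`): a maximal set of
formulas with parameters in `A` which is consistent with the elementary diagram of
`M`, i.e. finitely satisfiable in `M`. -/
def IsCompleteTypeOver (M : Theory.ModelType.{u, u, u} T) (A : Set M)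
    (q : Set (L.Formula (γ ⊕ ↥A))) : Prop :=
  (∀ l : List (L.Formula (γ ⊕ ↥A)), (∀ φ ∈ l, φ ∈ q) →
      ∃ x : γ → M, (listConj l).Realize (Sum.elim x Subtype.val)) ∧
  (∀ φ : L.Formula (γ ⊕ ↥A), φ ∈ q ∨ φ.not ∈ q)

/-- The restriction of a type over `A` to a type over a subset `B ⊆ A`. -/
def restrictT {M : Theory.ModelType.{u, u, u} T} {A B : Set M} (h : B ⊆ A)
    (q : Set (L.Formula (γ ⊕ ↥A))) : Set (L.Formula (γ ⊕ ↥B)) :=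
  { φ | φ.relabel (Sum.map id (Set.inclusion h)) ∈ q }

/-- A *global bigness notion* `Γ` for `T` (with the parameter set `A_Γ` absorbed into
the language as constants): an assignment, to each model `M` of `T` and each parameter
set `A ⊆ M`, of a collection of *`Γ`-big* complete types over `A`, satisfying local
character, extension and existence. -/
structure GlobalBigness (L : FirstOrder.Language.{u, u}) (T : L.Theory) (γ : Type u) :
    Type (u + 1) where
  Big : ∀ (M : Theory.ModelType.{u, u, u} T) (A : Set M),
    Set (L.Formula (γ ⊕ ↥A)) → Prop
  localChar : ∀ (M : Theory.ModelType.{u, u, u} T) (A : Set M)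
      (q : Set (L.Formula (γ ⊕ ↥A))), IsCompleteTypeOver M A q →
      (Big M A q ↔ ∀ (B : Set M) (hBA : B ⊆ A), B.Finite → Big M B (restrictT hBA q))
  extension : ∀ (M : Theory.ModelType.{u, u, u} T) (A B : Set M) (hAB : A ⊆ B)
      (q : Set (L.Formula (γ ⊕ ↥A))), IsCompleteTypeOver M A q → Big M A q →
      ∃ q' : Set (L.Formula (γ ⊕ ↥B)),
        IsCompleteTypeOver M B q' ∧ Big M B q' ∧ restrictT hAB q' = q
  existence : ∀ (M : Theory.ModelType.{u, u, u} T) (A : Set M),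
      ∃ q : Set (L.Formula (γ ⊕ ↥A)), IsCompleteTypeOver M A q ∧ Big M A q

/-- A local bigness notion is *invariant* if whether `φ(x̄_Γ, ā)` is `Γ`-big in a model
depends only on `φ(x̄, ȳ)` and on the complete first-order type of `ā` over `A_Γ`
(the parameters `A_Γ` being constants of the language). -/
def LocalBigness.Invariant (Γ : LocalBigness L T γ) : Prop :=
  ∀ (M N : Theory.ModelType.{u, u, u} T) (n : ℕ) (φ : L.Formula (γ ⊕ Fin n))
    (a : Fin n → M) (b : Fin n → N),
    (∀ ψ : L.Formula (Fin n), ψ.Realize a ↔ ψ.Realize b) →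
    (Γ.Big M (φ.relabel (Sum.map id a)) ↔ Γ.Big N (φ.relabel (Sum.map id b)))

/-- A global bigness notion is *invariant* if `Γ`-bigness of `tp(ā, A, M)` is preserved
by elementary maps (fixing the parameters `A_Γ`, which are constants, pointwise). -/
def GlobalBigness.Invariant (Γ : GlobalBigness L T γ) : Prop :=
  ∀ (M N : Theory.ModelType.{u, u, u} T) (A : Set M) (B : Set N)
    (a : γ → M) (b : γ → N) (e : ↥A → ↥B), Function.Surjective e →
    (∀ φ : L.Formula (γ ⊕ ↥A),
      φ.Realize (Sum.elim a Subtype.val) ↔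
        (φ.relabel (Sum.map id e)).Realize (Sum.elim b Subtype.val)) →
    (Γ.Big M A (typeOf M A a) ↔ Γ.Big N B (typeOf N B b))

/-- `b` realizes, over the image of `A` under the elementary embedding `emb : M → N`,
the type that `a` realizes over `A` in `M`. -/
def RealizesTypeOf {M N : Theory.ModelType.{u, u, u} T} (emb : M ↪ₑ[L] N)
    (A : Set M) (a : γ → M) (b : γ → N) : Prop :=
  ∀ φ : L.Formula (γ ⊕ ↥A),
    φ.Realize (Sum.elim a Subtype.val) ↔ φ.Realize (Sum.elim b fun x => emb x.val)

/-- Orthogonality of two (global) bigness notions, given by their bigness predicates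
on types: whenever `tp(āˡ, A, M)` is `Γℓ`-big for `ℓ = 1,2`, there are an elementary
extension `N` of `M` and tuples `b̄ˡ` in `N` realizing `tp(āˡ, A, M)` such that
`tp(b̄ˡ, A ∪ b̄^(3−ℓ), N)` is `Γℓ`-big. -/
def Orthogonal {γ₁ γ₂ : Type u}
    (B₁ : ∀ (M : Theory.ModelType.{u, u, u} T) (A : Set M),
      Set (L.Formula (γ₁ ⊕ ↥A)) → Prop)
    (B₂ : ∀ (M : Theory.ModelType.{u, u, u} T) (A : Set M),
      Set (L.Formula (γ₂ ⊕ ↥A)) → Prop) : Prop :=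
  ∀ (M : Theory.ModelType.{u, u, u} T) (A : Set M) (a₁ : γ₁ → M) (a₂ : γ₂ → M),
    B₁ M A (typeOf M A a₁) → B₂ M A (typeOf M A a₂) →
    ∃ (N : Theory.ModelType.{u, u, u} T) (emb : M ↪ₑ[L] N) (b₁ : γ₁ → N) (b₂ : γ₂ → N),
      RealizesTypeOf emb A a₁ b₁ ∧ RealizesTypeOf emb A a₂ b₂ ∧
      B₁ N (⇑emb '' A ∪ Set.range b₂) (typeOf N (⇑emb '' A ∪ Set.range b₂) b₁) ∧
      B₂ N (⇑emb '' A ∪ Set.range b₁) (typeOf N (⇑emb '' A ∪ Set.range b₁) b₂)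

/-- `Γ` is `λ`-presentable (parameter-free version, `A_Γ = ∅`): there are an index
set `I` with `|I| < λ`, variable tuples `x̄^i` (`i ∈ I`) and a set `Δ` of fewer than
`λ` formulas in these variables such that `φ(x̄_Γ, b̄)` is `Γ`-big in `M` iff
`{φ(x̄^i, b̄) : i ∈ I} ∪ Δ` is finitely satisfiable in `M`. -/
def PresentableP (Γ : LocalBigness L T γ) (lam : Cardinal.{u}) : Prop :=
  ∃ (I : Type u) (Δ : Set (L.Formula (I × γ))),
    Cardinal.mk I < lam ∧ Cardinal.mk ↥Δ < lam ∧
    ∀ (M : Theory.ModelType.{u, u, u} T) (φ : L.Formula (γ ⊕ M)),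
      Γ.Big M φ ↔
        ∀ l : List (L.Formula ((I × γ) ⊕ M)),
          (∀ ψ ∈ l, (∃ i : I, ψ = φ.relabel (Sum.map (fun g => (i, g)) id)) ∨
            ∃ θ ∈ Δ, ψ = Formula.relabel Sum.inl θ) →
          ∃ v : I × γ → M, ∀ ψ ∈ l, Formula.Realize ψ (Sum.elim v id)

theorem exists_list_map_eq {α β : Type u} {f : α → β} {p : Set α} {l : List β}
    (hl : ∀ b ∈ l, b ∈ f '' p) : ∃ l' : List α, (∀ a ∈ l', a ∈ p) ∧ l'.map f = l := by
  induction l with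
  | nil => exact ⟨[], by simp, rfl⟩
  | cons b l ih =>
    obtain ⟨a, ha, rfl⟩ := hl b (by simp)
    obtain ⟨l', hl', rfl⟩ := ih fun c hc => hl c (by simp [hc])
    exact ⟨a :: l', by simpa [ha] using hl', rfl⟩

theorem realize_listConj {α : Type u} {M : Type u} [L.Structure M] (l : List (L.Formula α))
    (v : α → M) : (listConj l).Realize v ↔ ∀ φ ∈ l, φ.Realize v := by
  induction l with
  | nil => simp [listConj]
  | cons φ l ih => simp [listConj, ih]

/-- A set of formulas with parameters in `M` is finitely satisfiable in `M`. -/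
def FinSat (M : Theory.ModelType.{u, u, u} T) (S : Set (L.Formula (γ ⊕ M))) : Prop :=
  ∀ l : List (L.Formula (γ ⊕ M)), (∀ φ ∈ l, φ ∈ S) →
    ∃ v : γ → M, ∀ φ ∈ l, φ.Realize (Sum.elim v id)

/-- Some ultrapower of `M` realizes every set of formulas over `M` in the variables `γ` which is
finitely satisfiable in `M`; and every formula over `M` satisfiable in the ultrapower is
satisfiable in `M`. -/
theorem exists_elementary_realizing (M : Theory.ModelType.{u, u, u} T) (γ : Type u) :
    ∃ (N : Theory.ModelType.{u, u, u} T) (j : M ↪ₑ[L] N),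
      (∀ S : Set (L.Formula (γ ⊕ M)), FinSat M S →
        ∃ v : γ → N, ∀ φ ∈ S, φ.Realize (Sum.elim v j)) ∧
      ∀ (φ : L.Formula (γ ⊕ M)) (v : γ → N), φ.Realize (Sum.elim v j) →
        ∃ w : γ → M, φ.Realize (Sum.elim w id) := by
  classical
  let I := Finset (L.Formula (γ ⊕ M))
  let U : Ultrafilter I := Ultrafilter.of Filter.atTop
  have hmem : ∀ φ : L.Formula (γ ⊕ M), ∀ᶠ i : I in U, φ ∈ i := fun φ =>
    Ultrafilter.of_le Filter.atTop
      (Filter.mem_of_superset (Filter.mem_atTop ({φ} : Finset (L.Formula (γ ⊕ M))))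
        fun i hi => Finset.singleton_subset_iff.1 hi)
  let P := (U : Filter I).Product fun _ => (M : Type u)
  have hmodel : P ⊨ T := ⟨fun σ hσ => (Ultraproduct.sentence_realize σ).2
    (Filter.Eventually.of_forall fun _ => Theory.realize_sentence_of_mem T hσ)⟩
  let N : Theory.ModelType.{u, u, u} T := Theory.ModelType.of T P
  let mk : (I → M) → N := fun f => (Quotient.mk'' f : P)
  have los : ∀ {β : Type u} (φ : L.Formula β) (x : β → I → M),
      φ.Realize (fun b => mk (x b)) ↔ ∀ᶠ i in U, φ.Realize fun b => x b i :=
    fun φ x => Ultraproduct.realize_formula_cast (M := fun _ : I => (M : Type u)) (u := U) φ x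
  let j : M ↪ₑ[L] N :=
    { toFun := fun m => mk fun _ => m
      map_formula' := fun n φ x => by
        refine (Ultraproduct.realize_formula_cast (M := fun _ : I => (M : Type u)) (u := U) φ
          (fun b _ => x b)).trans ?_
        exact Filter.eventually_const }
  have los' : ∀ (φ : L.Formula (γ ⊕ M)) (x : γ → I → M),
      φ.Realize (Sum.elim (fun b => mk (x b)) j) ↔
        ∀ᶠ i in U, φ.Realize (Sum.elim (fun b => x b i) id) := by
    intro φ x
    have h := los φ (Sum.elim x fun m _ => m)
    convert h using 2
    · ext b; cases b <;> rfl
    · ext i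
      apply iff_of_eq
      congr 1
      ext b; cases b <;> rfl
  refine ⟨N, j, ?_, ?_⟩
  · intro S hS
    choose w hw using fun i : I => hS (i.toList.filter (· ∈ S)) (by simp)
    refine ⟨fun b => mk fun i => w i b, fun φ hφ => (los' φ _).2 ?_⟩
    filter_upwards [hmem φ] with i hi
    exact hw i φ (by simp [hi, hφ])
  · intro φ v h
    choose x hx using fun b => Quotient.exists_rep (v b)
    have hv : v = fun b => mk (x b) := funext fun b => (hx b).symm
    rw [hv, los'] at h
    obtain ⟨i, hi⟩ := h.exists
    exact ⟨_, hi⟩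

/-- The solution set of a formula in one variable. -/
def solutions {M : Theory.ModelType.{u, u, u} T} (φ : L.Formula (PUnit.{u + 1} ⊕ M)) : Set M :=
  { x | φ.Realize (Sum.elim (fun _ => x) id) }

theorem infinite_iff_forall_finset {α : Type u} (S : Set α) :
    S.Infinite ↔ ∀ n : ℕ, ∃ s : Finset α, n ≤ s.card ∧ ∀ x ∈ s, x ∈ S := by
  constructor
  · intro h n
    obtain ⟨s, hs, hn⟩ := h.exists_subset_card_eq n
    exact ⟨s, hn.ge, fun x hx => hs hx⟩
  · intro h hf
    obtain ⟨s, hn, hs⟩ := h (hf.toFinset.card + 1)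
    have := Finset.card_le_card (s := s) (t := hf.toFinset) fun x hx => by simpa using hs x hx
    omega

theorem infinite_iff_forall_injective {α : Type u} (S : Set α) :
    S.Infinite ↔ ∀ n : ℕ, ∃ v : Fin n → α, Function.Injective v ∧ ∀ i, v i ∈ S := by
  constructor
  · intro h n
    obtain ⟨s, hs, hn⟩ := h.exists_subset_card_eq n
    refine ⟨fun i => s.equivFin.symm (Fin.cast hn.symm i), ?_, fun i => hs (Subtype.prop _)⟩
    intro i k hik
    simpa using s.equivFin.symm.injective (Subtype.ext hik)
  · rw [infinite_iff_forall_finset]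
    intro h n
    obtain ⟨v, hv, hS⟩ := h n
    refine ⟨Finset.univ.map ⟨v, hv⟩, by simp, ?_⟩
    simpa using hS

/-- The formula stating that two variables take distinct values. -/
def distinctFormula {I : Type u} (i k : I) : L.Formula (I × PUnit.{u + 1}) :=
  ((Term.var (i, PUnit.unit)).equal (Term.var (k, PUnit.unit))).not

theorem realize_distinctFormula {I : Type u} {M : Type u} [L.Structure M] (i k : I)
    (v : I × PUnit.{u + 1} → M) :
    (distinctFormula (L := L) i k).Realize v ↔ v (i, PUnit.unit) ≠ v (k, PUnit.unit) := by
  simp [distinctFormula]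

theorem realize_relabel_copy {I : Type u} {M : Theory.ModelType.{u, u, u} T}
    (φ : L.Formula (γ ⊕ M)) (i : I) (v : I × γ → M) :
    (φ.relabel (Sum.map (fun g => (i, g)) id)).Realize (Sum.elim v id) ↔
      φ.Realize (Sum.elim (fun g => v (i, g)) id) := by
  rw [Formula.realize_relabel, Sum.elim_comp_map]; rfl

theorem realize_relabel_inl {M : Theory.ModelType.{u, u, u} T}
    (θ : L.Formula γ) (v : γ → M) :
    (Formula.relabel Sum.inl θ : L.Formula (γ ⊕ M)).Realize (Sum.elim v id) ↔ θ.Realize v := by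
  rw [Formula.realize_relabel, Sum.elim_comp_inl]

/-- The formulas expressing that the variables indexed by `I` are pairwise distinct and that each
of them realizes `p`. -/
def distinctCopies {M : Theory.ModelType.{u, u, u} T} (I : Type u)
    (p : Set (L.Formula (PUnit.{u + 1} ⊕ M))) : Set (L.Formula ((I × PUnit.{u + 1}) ⊕ M)) :=
  { ψ | (∃ φ ∈ p, ∃ i : I, ψ = φ.relabel (Sum.map (fun g => (i, g)) id)) ∨
    ∃ i k : I, i ≠ k ∧ ψ = Formula.relabel Sum.inl (distinctFormula i k) }

theorem finSat_distinctCopies {M : Theory.ModelType.{u, u, u} T} (I : Type u)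
    (p : Set (L.Formula (PUnit.{u + 1} ⊕ M)))
    (hp : ∀ l : List (L.Formula (PUnit.{u + 1} ⊕ M)), (∀ φ ∈ l, φ ∈ p) →
      (solutions (listConj l)).Infinite) :
    FinSat M (distinctCopies I p) := by
  classical
  intro l hl
  have key : ∃ (J : Finset I) (F : List (L.Formula (PUnit.{u + 1} ⊕ M))), (∀ φ ∈ F, φ ∈ p) ∧
      ∀ v : I → M, Set.InjOn v J → (∀ i ∈ J, v i ∈ solutions (listConj F)) →
        ∀ ψ ∈ l, ψ.Realize (Sum.elim (fun b : I × PUnit.{u + 1} => v b.1) id) := by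
    induction l with
    | nil => exact ⟨∅, [], by simp, by simp⟩
    | cons ψ l ih =>
      obtain ⟨J, F, hF, h⟩ := ih fun φ hφ => hl φ (by simp [hφ])
      rcases hl ψ (by simp) with ⟨φ, hφ, i, rfl⟩ | ⟨i, k, hik, rfl⟩
      · refine ⟨insert i J, φ :: F, by simpa [hφ] using hF, fun v hv hs => ?_⟩
        simp only [solutions, Set.mem_ofPred_eq, realize_listConj, List.mem_cons,
          forall_eq_or_imp] at hs h ⊢
        refine ⟨(realize_relabel_copy φ i _).2 (hs i (by simp)).1, h v (hv.mono (by simp)) ?_⟩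
        exact fun k hk => (hs k (by simp [hk])).2
      · refine ⟨insert i (insert k J), F, hF, fun v hv hs => ?_⟩
        simp only [List.mem_cons, forall_eq_or_imp]
        refine ⟨?_, h v (hv.mono ?_) fun k hk => hs k (by simp [hk])⟩
        · rw [realize_relabel_inl, realize_distinctFormula]
          exact fun e => hik (hv (by simp) (by simp) e)
        · intro x hx; simp [Finset.mem_coe.1 hx]
  obtain ⟨J, F, hF, h⟩ := key
  obtain ⟨w, hw, hs⟩ := (infinite_iff_forall_injective _).1 (hp F hF) J.card
  let v : I → M := fun i => if hi : i ∈ J then w (J.equivFin ⟨i, hi⟩) else Classical.arbitrary M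
  refine ⟨fun b => v b.1, h v ?_ ?_⟩
  · intro i hi k hk e
    rw [Finset.mem_coe] at hi hk
    simp only [v, hi, hk, dif_pos] at e
    simpa using J.equivFin.injective (hw e)
  · intro i hi
    simp only [v, hi, dif_pos]
    exact hs _

/-- The non-algebraicity bigness notion: a formula is big if its solution set is infinite. -/
def nonAlgebraic (hInf : ∀ M : Theory.ModelType.{u, u, u} T, Infinite M) :
    LocalBigness L T PUnit.{u + 1} where
  Big _ φ := (solutions φ).Infinite
  aut_invariant M g φ := by
    have h : solutions φ = g ⁻¹' solutions (φ.relabel (Sum.map id ⇑g)) := by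
      ext x
      simp only [solutions, Set.mem_ofPred_eq, Set.mem_preimage, Formula.realize_relabel,
        Sum.elim_comp_map]
      rw [← StrongHomClass.realize_formula g]
      apply iff_of_eq
      congr 1
      ext b; cases b <;> rfl
    rw [h]
    exact not_congr ⟨fun hf => hf.preimage g.injective.injOn,
      fun hf => Set.finite_of_finite_preimage hf (by simp [g.surjective.range_eq])⟩
  mono M φ ψ h hφ := hφ.mono fun x hx => h _ hx
  small_sup M φ ψ hφ hψ := by
    rw [Set.not_infinite] at *
    refine (hφ.union hψ).subset fun x hx => ?_
    simpa [solutions] using hx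
  small_bot M := by
    rw [Set.not_infinite]
    convert Set.finite_empty
    ext x
    simp [solutions]
  exists_big M := by
    have := hInf M
    refine ⟨⊤, ?_⟩
    convert Set.infinite_univ (α := M)
    ext x
    simp [solutions]

theorem nonAlgebraic_presentable (hInf : ∀ M : Theory.ModelType.{u, u, u} T, Infinite M) :
    PresentableP (nonAlgebraic hInf) ℵ₁ := by
  let Δ : Set (L.Formula (ULift.{u} ℕ × PUnit.{u + 1})) :=
    (fun q : ULift.{u} ℕ × ULift.{u} ℕ => distinctFormula q.1 q.2) '' { q | q.1 ≠ q.2 }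
  refine ⟨ULift.{u} ℕ, Δ, ?_, ?_, ?_⟩
  · rw [lt_aleph_one_iff]
    exact mk_le_aleph0
  · rw [lt_aleph_one_iff]
    exact ((Set.to_countable _).image _).le_aleph0
  · intro M φ
    constructor
    · intro h l hl
      refine finSat_distinctCopies (ULift.{u} ℕ) {φ} (fun F hF => ?_) l fun ψ hψ => ?_
      · refine h.mono fun x hx => (realize_listConj _ _).2 fun θ hθ => ?_
        rw [hF θ hθ]
        exact hx
      · rcases hl ψ hψ with ⟨i, rfl⟩ | ⟨_, ⟨q, hq, rfl⟩, rfl⟩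
        · exact Or.inl ⟨φ, rfl, i, rfl⟩
        · exact Or.inr ⟨q.1, q.2, hq, rfl⟩
    · intro h
      refine (infinite_iff_forall_injective _).2 fun n => ?_
      let f : Fin n → ULift.{u} ℕ := fun i => ⟨i⟩
      have hf : Function.Injective f := fun i k e => Fin.ext (congrArg ULift.down e)
      obtain ⟨v, hv⟩ := h
        ((List.finRange n).map (fun i => φ.relabel (Sum.map (fun g => (f i, g)) id)) ++
          ((List.finRange n ×ˢ List.finRange n).filter fun q => q.1 ≠ q.2).map
            fun q => Formula.relabel Sum.inl (distinctFormula (f q.1) (f q.2))) (by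
        intro ψ hψ
        simp only [List.mem_append, List.mem_map, List.mem_filter] at hψ
        rcases hψ with ⟨i, -, rfl⟩ | ⟨q, ⟨-, hq⟩, rfl⟩
        · exact Or.inl ⟨_, rfl⟩
        · exact Or.inr ⟨_, ⟨(f q.1, f q.2), fun e => (of_decide_eq_true hq) (hf e), rfl⟩, rfl⟩)
      refine ⟨fun i => v (f i, PUnit.unit), ?_, fun i => ?_⟩
      · intro i k e
        by_contra hik
        have := hv (Formula.relabel Sum.inl (distinctFormula (f i) (f k))) (by
          refine List.mem_append_right _ (List.mem_map.2 ⟨(i, k), ?_, rfl⟩)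
          simpa using hik)
        rw [realize_relabel_inl, realize_distinctFormula] at this
        exact this e
      · exact (realize_relabel_copy φ (f i) v).1
          (hv _ (List.mem_append_left _ (List.mem_map.2 ⟨i, List.mem_finRange i, rfl⟩)))

/-- The formula stating that `φ` has at least `k` solutions. -/
noncomputable def atLeast {n : ℕ} (φ : L.Formula (PUnit.{u + 1} ⊕ Fin n)) (k : ℕ) :
    L.Formula (Fin n) :=
  Formula.iExs (Fin k)
    ((Formula.iInf fun i : Fin k => φ.relabel (Sum.elim (fun _ => Sum.inr i) Sum.inl)) ⊓
      Formula.iInf fun q : { q : Fin k × Fin k // q.1 ≠ q.2 } =>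
        ((Term.var (Sum.inr q.1.1)).equal (Term.var (Sum.inr q.1.2))).not)

theorem realize_atLeast {M : Theory.ModelType.{u, u, u} T} {n : ℕ}
    (φ : L.Formula (PUnit.{u + 1} ⊕ Fin n)) (k : ℕ) (a : Fin n → M) :
    (atLeast φ k).Realize a ↔
      ∃ v : Fin k → M, Function.Injective v ∧ ∀ i, v i ∈ solutions (φ.relabel (Sum.map id a)) := by
  rw [atLeast, Formula.realize_iExs]
  refine exists_congr fun v => ?_
  rw [Formula.realize_inf, Formula.realize_iInf, Formula.realize_iInf, and_comm]
  refine and_congr ?_ (forall_congr' fun i => ?_)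
  · constructor
    · intro h i j e
      by_contra hij
      simpa [e] using h ⟨(i, j), hij⟩
    · rintro h ⟨⟨i, j⟩, hij⟩
      simpa using fun e => hij (h e)
  · simp only [solutions, Set.mem_ofPred_eq, Formula.realize_relabel]
    apply iff_of_eq
    congr 1
    ext b; cases b <;> rfl

theorem nonAlgebraic_invariant (hInf : ∀ M : Theory.ModelType.{u, u, u} T, Infinite M) :
    (nonAlgebraic hInf).Invariant := by
  intro M N n φ a b h
  refine (infinite_iff_forall_injective _).trans
    (Iff.trans (forall_congr' fun k => ?_) (infinite_iff_forall_injective _).symm)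
  rw [← realize_atLeast, ← realize_atLeast, h]

theorem isCompleteTypeOver_typeOf (M : Theory.ModelType.{u, u, u} T) (A : Set M) (a : γ → M) :
    IsCompleteTypeOver M A (typeOf M A a) :=
  ⟨fun _ hl => ⟨a, (realize_listConj _ _).2 hl⟩, fun φ => by
    simpa [typeOf] using em (φ.Realize (Sum.elim a Subtype.val))⟩

theorem restrictT_typeOf {M : Theory.ModelType.{u, u, u} T} {A B : Set M} (h : B ⊆ A)
    (a : γ → M) : restrictT h (typeOf M A a) = typeOf M B a := by
  ext φ
  simp only [restrictT, typeOf, Set.mem_ofPred_eq, Formula.realize_relabel, Sum.elim_comp_map]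
  rfl

theorem GlobalBigness.Big.restrict {Γ : GlobalBigness L T γ} {M : Theory.ModelType.{u, u, u} T}
    {A B : Set M} {a : γ → M} (hA : Γ.Big M A (typeOf M A a)) (h : B ⊆ A) :
    Γ.Big M B (typeOf M B a) := by
  refine (Γ.localChar M B _ (isCompleteTypeOver_typeOf M B a)).2 fun C hC hfin => ?_
  have := (Γ.localChar M A _ (isCompleteTypeOver_typeOf M A a)).1 hA C (hC.trans h) hfin
  rwa [restrictT_typeOf] at this ⊢

theorem realize_comp_elementaryEmbedding {M N : Theory.ModelType.{u, u, u} T} (j : M ↪ₑ[L] N)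
    {A : Set M} (a : γ → M) (φ : L.Formula (γ ⊕ ↥A)) :
    φ.Realize (Sum.elim (j ∘ a) fun x => j x.val) ↔
      φ.Realize (Sum.elim a Subtype.val) := by
  rw [← j.map_formula φ, Sum.comp_elim]
  rfl

theorem GlobalBigness.Invariant.map {Γ : GlobalBigness L T γ} (hΓ : Γ.Invariant)
    {M N : Theory.ModelType.{u, u, u} T} (j : M ↪ₑ[L] N) {A : Set M} {a : γ → M}
    (h : Γ.Big M A (typeOf M A a)) : Γ.Big N (j '' A) (typeOf N (j '' A) (j ∘ a)) := by
  refine (hΓ M N A (j '' A) a (j ∘ a) (fun x => ⟨j x.val, x.val, x.prop, rfl⟩) ?_ ?_).1 h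
  · rintro ⟨_, x, hx, rfl⟩
    exact ⟨⟨x, hx⟩, rfl⟩
  · intro φ
    rw [Formula.realize_relabel, Sum.elim_comp_map, ← realize_comp_elementaryEmbedding j]
    rfl

/-- There is an elementary extension of `M` in which all complete types over `M` in the variables
`γ` are realized. -/
theorem exists_elementary_realizing_types (M : Theory.ModelType.{u, u, u} T) (γ : Type u) :
    ∃ (N : Theory.ModelType.{u, u, u} T) (j : M ↪ₑ[L] N),
      ∀ q : Set (L.Formula (γ ⊕ ↥(Set.range j))), IsCompleteTypeOver N (Set.range j) q →
        ∃ v : γ → N, q = typeOf N (Set.range j) v := by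
  obtain ⟨N, j, hreal, hsat⟩ := exists_elementary_realizing M γ
  refine ⟨N, j, fun q hq => ?_⟩
  choose s hs using fun y : ↥(Set.range j) => y.prop
  have hrel : ∀ (ψ : L.Formula (γ ⊕ ↥(Set.range j))) (v : γ → N),
      (ψ.relabel (Sum.map id s)).Realize (Sum.elim v j) ↔
        ψ.Realize (Sum.elim v Subtype.val) := by
    intro ψ v
    rw [Formula.realize_relabel, Sum.elim_comp_map, (funext hs : ⇑j ∘ s = Subtype.val)]
    rfl
  obtain ⟨v, hv⟩ := hreal (Formula.relabel (Sum.map id s) '' q) (by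
    intro l hl
    obtain ⟨l', hl', rfl⟩ := exists_list_map_eq hl
    obtain ⟨x, hx⟩ := hq.1 l' hl'
    rw [realize_listConj] at hx
    obtain ⟨w, hw⟩ := hsat (listConj (l'.map (Formula.relabel (Sum.map id s)))) x (by
      rw [realize_listConj]
      simpa [hrel] using hx)
    exact ⟨w, (realize_listConj _ _).1 hw⟩)
  have hsub : ∀ ψ ∈ q, ψ.Realize (Sum.elim v Subtype.val) := fun ψ hψ =>
    (hrel ψ v).1 (hv _ ⟨ψ, hψ, rfl⟩)
  refine ⟨v, Set.Subset.antisymm hsub fun ψ hψ => ?_⟩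
  refine (hq.2 ψ).resolve_right fun hn => ?_
  exact (Formula.realize_not.1 (hsub _ hn)) hψ

/-- There is an elementary extension of `M` with arbitrarily many realizations of a given
non-algebraic type. -/
theorem exists_elementary_many_realizations
    (hInf : ∀ M : Theory.ModelType.{u, u, u} T, Infinite M)
    (M : Theory.ModelType.{u, u, u} T) (A : Set M) (a : PUnit.{u + 1} → M)
    (ha : (nonAlgebraic hInf).BigType M A (typeOf M A a)) (X : Type u) :
    ∃ (N : Theory.ModelType.{u, u, u} T) (j : M ↪ₑ[L] N) (c : X → N), Function.Injective c ∧
      ∀ x, RealizesTypeOf j A a fun _ => c x := by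
  obtain ⟨N, j, hreal, -⟩ := exists_elementary_realizing M (X × PUnit.{u + 1})
  let p : Set (L.Formula (PUnit.{u + 1} ⊕ M)) :=
    (fun φ => Formula.relabel (Sum.map id Subtype.val) φ) '' typeOf M A a
  obtain ⟨v, hv⟩ := hreal (distinctCopies X p) (finSat_distinctCopies X p (by
    intro l hl
    obtain ⟨l', hl', rfl⟩ := exists_list_map_eq hl
    refine (ha l' hl').mono fun x hx => ?_
    simp only [solutions, Set.mem_ofPred_eq, realize_listConj, Formula.realize_relabel,
      List.mem_map, forall_exists_index, and_imp, forall_apply_eq_imp_iff₂] at hx ⊢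
    exact hx))
  have hmem : ∀ x, ∀ φ ∈ typeOf M A a,
      φ.Realize (Sum.elim (fun _ => v (x, PUnit.unit)) fun y => j y.val) := by
    intro x φ hφ
    have := hv _ (Or.inl ⟨_, ⟨φ, hφ, rfl⟩, x, rfl⟩)
    rw [Formula.realize_relabel, Formula.realize_relabel, Sum.elim_comp_map,
      Sum.elim_comp_map] at this
    exact this
  refine ⟨N, j, fun x => v (x, PUnit.unit), ?_, fun x φ => ⟨hmem x φ, fun h => ?_⟩⟩
  · intro x y e
    by_contra hxy
    have := hv _ (Or.inr ⟨x, y, hxy, rfl⟩)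
    rw [Formula.realize_relabel, Sum.elim_comp_inl, realize_distinctFormula] at this
    exact this e
  · by_contra hn
    exact Formula.realize_not.1 (hmem x φ.not (Formula.realize_not.2 hn)) h

/-- Among sufficiently many elements, one is non-algebraic over the range of `t`. -/
theorem exists_bigType_of_card_lt (hInf : ∀ M : Theory.ModelType.{u, u, u} T, Infinite M)
    (M : Theory.ModelType.{u, u, u} T) {δ : Type u} (t : δ → M) {X : Type u} (c : X → M)
    (hc : Function.Injective c)
    (hX : #(ℕ × L.Formula (PUnit.{u + 1} ⊕ δ)) < #X) :
    ∃ x, (nonAlgebraic hInf).BigType M (Set.range t) (typeOf M (Set.range t) fun _ => c x) := by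
  by_contra! hno
  have hf : ∀ x, ∃ φ : L.Formula (PUnit.{u + 1} ⊕ δ),
      c x ∈ solutions (φ.relabel (Sum.map id t)) ∧
        (solutions (φ.relabel (Sum.map id t))).Finite := by
    intro x
    have := hno x
    simp only [LocalBigness.BigType, not_forall] at this
    obtain ⟨l, hl, hfin⟩ := this
    refine ⟨(listConj l).relabel (Sum.map id fun y => y.prop.choose), ?_⟩
    have heq : solutions (((listConj l).relabel (Sum.map id fun y => y.prop.choose)).relabel
        (Sum.map id t)) = solutions ((listConj l).relabel (Sum.map id Subtype.val)) := by
      ext z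
      simp only [solutions, Set.mem_ofPred_eq, Formula.realize_relabel]
      apply iff_of_eq
      congr 1
      ext b
      rcases b with b | b
      · rfl
      · exact b.prop.choose_spec
    rw [heq]
    refine ⟨?_, Set.not_infinite.1 hfin⟩
    simp only [solutions, Set.mem_ofPred_eq, Formula.realize_relabel, Sum.elim_comp_map]
    exact (realize_listConj _ _).2 hl
  choose f hf using hf
  obtain ⟨⟨_, φ⟩, hφ⟩ := Cardinal.exists_infinite_fiber' (fun x => ((0 : ℕ), f x)) hX
  rw [Set.infinite_coe_iff] at hφ
  obtain ⟨x, hx⟩ := hφ.nonempty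
  have hfx : f x = φ := congrArg Prod.snd hx
  refine hφ.image hc.injOn ((hf x).2.subset ?_)
  rintro _ ⟨y, hy, rfl⟩
  have hfy : f y = φ := congrArg Prod.snd hy
  rw [hfx, ← hfy]
  exact (hf y).1

theorem nonAlgebraic_orthogonal (hInf : ∀ M : Theory.ModelType.{u, u, u} T, Infinite M)
    (Γ : GlobalBigness L T γ) (hΓ : Γ.Invariant) :
    Orthogonal (nonAlgebraic hInf).BigType Γ.Big := by
  intro M A a₁ a₂ h₁ h₂
  let X : Type u := Set (ℕ × L.Formula (PUnit.{u + 1} ⊕ (↥A ⊕ γ)))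
  obtain ⟨M₁, i, c, hc, hreal⟩ := exists_elementary_many_realizations hInf M A a₁ h₁ X
  obtain ⟨N, j, hj⟩ := exists_elementary_realizing_types M₁ γ
  let e : M ↪ₑ[L] N := j.comp i
  have hsub : e '' A ⊆ Set.range j := by
    rintro _ ⟨x, -, rfl⟩
    exact ⟨i x, rfl⟩
  obtain ⟨q, hq, hbig, hres⟩ := Γ.extension N (e '' A) (Set.range j) hsub _
    (isCompleteTypeOver_typeOf N _ _) (hΓ.map e h₂)
  obtain ⟨b, rfl⟩ := hj q hq
  rw [restrictT_typeOf] at hres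
  obtain ⟨x, hx⟩ := exists_bigType_of_card_lt hInf N
    (Sum.elim (fun y : ↥A => e y.val) b) (fun x => j (c x)) (j.injective.comp hc)
    (by rw [mk_set]; exact cantor _)
  refine ⟨N, e, fun _ => j (c x), b, ?_, ?_, ?_, ?_⟩
  · intro φ
    refine (hreal x φ).trans ?_
    rw [← j.map_formula φ, Sum.comp_elim]
    rfl
  · intro φ
    rw [← realize_comp_elementaryEmbedding e]
    let g : ↥A → ↥(e '' A) := fun y => ⟨e y.val, y.val, y.prop, rfl⟩
    have key : ∀ d : γ → N, φ.relabel (Sum.map id g) ∈ typeOf N (e '' A) d ↔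
        φ.Realize (Sum.elim d fun y => e y.val) := by
      intro d
      simp only [typeOf, Set.mem_ofPred_eq, Formula.realize_relabel, Sum.elim_comp_map]
      rfl
    rw [← key, ← key, hres]
  · have : Set.range (Sum.elim (fun y : ↥A => e y.val) b) = e '' A ∪ Set.range b := by
      rw [Set.Sum.elim_range, Set.image_eq_range]
    rwa [this] at hx
  · refine hbig.restrict (Set.union_subset hsub ?_)
    rintro _ ⟨-, rfl⟩
    exact ⟨c x, rfl⟩

/-!
Statement 8 (Claim 2.2(2)): for a complete first-order theory `T` with infinite
models, the non-algebraicity bigness notion `Γ^na` — in a single variable, with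
`A_{Γ^na} = ∅`, where `φ(x, ā)` is big in `M` iff it has at least `n` solutions for
every `n` — is an `ℵ₁`-presentable invariant local bigness notion, and, regarded as a
global bigness notion (via `Γ.BigType`), it is orthogonal to every invariant global
bigness notion for `T`.
-/
theorem na_bigness (hT : T.IsComplete)
    (hInf : ∀ M : Theory.ModelType.{u, u, u} T, Infinite M) :
    ∃ Γ : LocalBigness L T PUnit.{u + 1},
      (∀ (M : Theory.ModelType.{u, u, u} T) (φ : L.Formula (PUnit.{u + 1} ⊕ M)),
        Γ.Big M φ ↔ ∀ n : ℕ, ∃ s : Finset M, n ≤ s.card ∧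
          ∀ x ∈ s, Formula.Realize φ (Sum.elim (fun _ => x) id)) ∧
      PresentableP Γ ℵ₁ ∧
      Γ.Invariant ∧
      ∀ (γ' : Type u) (Γ' : GlobalBigness L T γ'), Γ'.Invariant →
        Orthogonal Γ.BigType Γ'.Big := by
  exact ⟨nonAlgebraic hInf, fun M φ => infinite_iff_forall_finset _,
    nonAlgebraic_presentable hInf, nonAlgebraic_invariant hInf,
    fun γ' Γ' hΓ' => nonAlgebraic_orthogonal hInf Γ' hΓ'⟩

end Shelah482
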